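/- Let (A,{·,·,·}) be a 3-pre-Lie algebra over a field of characteristic zero, with [x,y,z]_C := {x,y,z} + {y,z,x} + {z,x,y}. Then for all x1,...,x5 in A: (a) {[x1,x2,x3]_C,x4,x5} − {[x1,x2,x4]_C,x3,x5} + {[x1,x3,x4]_C,x2,x5} − {[x2,x3,x4]_C,x1,x5} = 0, and (b) {x1,x2,{x3,x4,x5}} + {x3,x4,{x1,x2,x5}} + {x2,x4,{x3,x1,x5}} + {x3,x1,{x2,x4,x5}} + {x2,x3,{x1,x4,x5}} + {x1,x4,{x2,x3,x5}} = 0. -/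

import Mathlib

/-- The 3-commutator `[x,y,z]_C = {x,y,z} + {y,z,x} + {z,x,y}` of a trilinear map. -/
def cBr {k A : Type*} [Field k] [AddCommGroup A] [Module k A]
    (p : A →ₗ[k] A →ₗ[k] A →ₗ[k] A) (x y z : A) : A :=
  p x y z + p y z x + p z x y

/-- two identities satisfied by any 3-pre-Lie algebra. -/
theorem stmt13 {k A : Type*} [Field k] [CharZero k] [AddCommGroup A] [Module k A]
    (p : A →ₗ[k] A →ₗ[k] A →ₗ[k] A)
    (hpskew : ∀ x y z : A, p x y z = - p y x z)
    (hp1 : ∀ x1 x2 x3 x4 x5 : A,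
      p x1 x2 (p x3 x4 x5) =
        p (cBr p x1 x2 x3) x4 x5 + p x3 (cBr p x1 x2 x4) x5 + p x3 x4 (p x1 x2 x5))
    (hp2 : ∀ x1 x2 x3 x4 x5 : A,
      p (cBr p x1 x2 x3) x4 x5 =
        p x1 x2 (p x3 x4 x5) + p x2 x3 (p x1 x4 x5) + p x3 x1 (p x2 x4 x5)) :
    (∀ x1 x2 x3 x4 x5 : A,
      p (cBr p x1 x2 x3) x4 x5 - p (cBr p x1 x2 x4) x3 x5
        + p (cBr p x1 x3 x4) x2 x5 - p (cBr p x2 x3 x4) x1 x5 = 0) ∧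
    (∀ x1 x2 x3 x4 x5 : A,
      p x1 x2 (p x3 x4 x5) + p x3 x4 (p x1 x2 x5) + p x2 x4 (p x3 x1 x5)
        + p x3 x1 (p x2 x4 x5) + p x2 x3 (p x1 x4 x5) + p x1 x4 (p x2 x3 x5) = 0) := by
  have inner_skew : ∀ u v x y z : A, p u v (p x y z) = - p u v (p y x z) := fun u v x y z => by
    rw [hpskew x y z, map_neg]
  have six_term : ∀ x1 x2 x3 x4 x5 : A,
      p x1 x2 (p x3 x4 x5) + p x3 x4 (p x1 x2 x5) + p x2 x4 (p x3 x1 x5)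
        + p x3 x1 (p x2 x4 x5) + p x2 x3 (p x1 x4 x5) + p x1 x4 (p x2 x3 x5) = 0 := by
    intro x1 x2 x3 x4 x5
    have h := hp1 x1 x2 x3 x4 x5
    rw [hpskew x3 (cBr p x1 x2 x4) x5, hp2, hp2, inner_skew x1 x2 x4 x3,
      inner_skew x2 x4 x1 x3, hpskew x4 x1] at h
    rw [← sub_eq_zero.mpr h.symm]
    abel
  refine ⟨fun x1 x2 x3 x4 x5 => ?_, six_term⟩
  have h := six_term x1 x2 x3 x4 x5
  rw [hp2, hp2, hp2, hp2, inner_skew x1 x2 x4 x3, inner_skew x2 x4 x1 x3, hpskew x4 x1,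
    hpskew x1 x3, inner_skew x3 x1 x4 x2, hpskew x4 x1, inner_skew x1 x4 x3 x2,
    inner_skew x2 x3 x4 x1, inner_skew x3 x4 x2 x1, hpskew x4 x2]
  linear_combination (norm := module) (2 : k) • h
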